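/- (Unsatisfiability inheritance) Let Sᵢ₊₁ be derived from a family of clause sets Sᵢ by applying one of the inference rules A1, A2, or A3. If some clause set in Sᵢ is unsatisfiable, then some clause set in Sᵢ₊₁ is unsatisfiable; equivalently, if every clause set in Sᵢ₊₁ is satisfiable, then every clause set in Sᵢ is satisfiable. -/

import Mathlib

/- Clause sets in ALC: a clause set is a finite set of clauses, a clause a
   finite set of concept literals (both represented by lists, with list
   membership as set membership, `++` as union and `filter` as removal). -/
namespace ALCCS

/-- Concept literals: A, ¬A, ∃R.F, ∀R.F where F is a clause set
    (concept names and role names are drawn from ℕ). -/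
inductive Lit : Type where
  | pos : ℕ → Lit                    -- concept name A
  | neg : ℕ → Lit                    -- negated concept name ¬A
  | ex  : ℕ → List (List Lit) → Lit  -- ∃R.F
  | all : ℕ → List (List Lit) → Lit  -- ∀R.F

/-- A clause: a finite set of concept literals (their disjunction). -/
abbrev Clause := List Lit
/-- A clause set: a finite set of clauses (their conjunction). -/
abbrev ClauseSet := List (List Lit)

/-- An interpretation with (nonempty) domain `D`. -/
structure Interp (D : Type) where
  cn  : ℕ → Set D
  rel : ℕ → D → D → Prop

mutual
/-- The extension L^I of a concept literal. -/
def litSem {D : Type} (I : Interp D) : Lit → Set D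
  | .pos a => I.cn a
  | .neg a => (I.cn a)ᶜ
  | .ex r F => {x | ∃ y, I.rel r x y ∧ y ∈ csSem I F}
  | .all r F => {x | ∀ y, I.rel r x y → y ∈ csSem I F}
/-- The extension of a clause: the union (disjunction) of its literals. -/
def clSem {D : Type} (I : Interp D) : List Lit → Set D
  | [] => ∅
  | L :: CL => litSem I L ∪ clSem I CL
/-- The extension of a clause set: the intersection (conjunction) of its clauses. -/
def csSem {D : Type} (I : Interp D) : List (List Lit) → Set D
  | [] => Set.univ
  | CL :: F => clSem I CL ∩ csSem I F
end

/-- A clause set is satisfiable if F^I ≠ ∅ for some interpretation. -/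
def Satisfiable (F : ClauseSet) : Prop :=
  ∃ (D : Type), Nonempty D ∧ ∃ I : Interp D, (csSem I F).Nonempty

/-- CNF of a disjunction of two clause sets (pairwise union of clauses). -/
def disjCS (F₁ F₂ : ClauseSet) : ClauseSet :=
  F₁.flatMap (fun c₁ => F₂.map (fun c₂ => c₁ ++ c₂))

mutual
/-- The complementary literal L̄: Ā = ¬A, (¬A)‾ = A, (∃R.F)‾ = ∀R.CNF(¬F),
    (∀R.F)‾ = ∃R.CNF(¬F). -/
def Lit.compl : Lit → Lit
  | .pos a => .neg a
  | .neg a => .pos a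
  | .ex r F => .all r (csNeg F)
  | .all r F => .ex r (csNeg F)
/-- CNF of the negation of a clause: the conjunction of the complements. -/
def clNeg : List Lit → List (List Lit)
  | [] => []
  | L :: CL => [L.compl] :: clNeg CL
/-- CNF(¬F) for a clause set F. -/
def csNeg : List (List Lit) → List (List Lit)
  | [] => [[]]
  | CL :: F => disjCS (clNeg CL) (csNeg F)
end

open Classical in
/-- Replace the clause `CL` by `newCL` in the clause set `F`. -/
noncomputable def replaceClause (F : ClauseSet) (CL newCL : Clause) : ClauseSet :=
  F.map (fun c => if c = CL then newCL else c)

open Classical in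
/-- Replace the clause set `F` by `F'` in the family `S`. -/
noncomputable def replaceCS (S : List ClauseSet) (F F' : ClauseSet) : List ClauseSet :=
  S.map (fun G => if G = F then F' else G)

open Classical in
/-- F \ {CL} : remove the clause `CL` from the clause set `F`. -/
noncomputable def removeClause (F : ClauseSet) (CL : Clause) : ClauseSet :=
  F.filter (fun c => decide (c ≠ CL))

open Classical in
/-- The effect of rule A2 (and A2⁺) on F for ∀R.F₁: remove from F all clauses
    containing ∀R.F₁ and replace every occurrence of ∃R.F₂ in clauses of F by
    ∃R.(F₁ ∪ F₂). -/
noncomputable def applyA2 (r : ℕ) (F₁ : ClauseSet) (F : ClauseSet) : ClauseSet :=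
  (F.filter (fun CL => decide (Lit.all r F₁ ∉ CL))).map
    (fun CL => CL.map (fun L => match L with
      | .ex r' F₂ => if r' = r then Lit.ex r' (F₁ ++ F₂) else Lit.ex r' F₂
      | L => L))

/-- A unit clause of the form {A}, {¬A}, or {∃R.F'}. -/
def IsA3Unit (CL : Clause) : Prop :=
  (∃ a, CL = [Lit.pos a]) ∨ (∃ a, CL = [Lit.neg a]) ∨ ∃ r F', CL = [Lit.ex r F']

/-- A family of clause sets is clash-free if none of its clause sets contains an
    empty clause or a pair {L}, {L̄} of complementary unit clauses. -/
def ClashFree (S : List ClauseSet) : Prop :=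
  ∀ F ∈ S, [] ∉ F ∧ ¬ ∃ L : Lit, [L] ∈ F ∧ [L.compl] ∈ F

/-- One derivation step Sᵢ → Sᵢ₊₁ of the reasoning algorithm with the inference
    rules A1, A2, and A3, acting on a clause set F ∈ Sᵢ. -/
inductive Step : List ClauseSet → List ClauseSet → Prop
  /-- (A1) if L ∈ CL for a clause CL of F (with |CL| ≥ 2), replace CL by {L} -/
  | a1 {S : List ClauseSet} {F : ClauseSet} {CL : Clause} {L : Lit} :
      F ∈ S → CL ∈ F → L ∈ CL → 2 ≤ CL.length →
      Step S (replaceCS S F (replaceClause F CL [L]))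
  /-- (A2) if ∀R.F₁ occurs in some clause of F, remove all clauses containing
      ∀R.F₁ and replace every ∃R.F₂ by ∃R.(F₁ ∪ F₂) -/
  | a2 {S : List ClauseSet} {F : ClauseSet} {CL : Clause} {r : ℕ} {F₁ : ClauseSet} :
      F ∈ S → CL ∈ F → Lit.all r F₁ ∈ CL →
      Step S (replaceCS S F (applyA2 r F₁ F))
  /-- (A3) if all clauses of F are unit clauses {A}, {¬A}, or {∃R.F'}, remove a
      unit clause {∃R.F₁} from F and add F₁ to the family -/
  | a3 {S : List ClauseSet} {F : ClauseSet} {r : ℕ} {F₁ : ClauseSet} :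
      F ∈ S → (∀ CL ∈ F, IsA3Unit CL) → [Lit.ex r F₁] ∈ F →
      Step S (replaceCS S F (removeClause F [Lit.ex r F₁]) ++ [F₁])

/-- A family is complete if no inference rule applies to it. -/
def Complete (S : List ClauseSet) : Prop := ¬ ∃ S', Step S S'

theorem mem_clSem_iff {D : Type} (I : Interp D) (CL : Clause) (x : D) :
    x ∈ clSem I CL ↔ ∃ L ∈ CL, x ∈ litSem I L := by
  induction CL with
  | nil => simp [clSem]
  | cons L CL ih => simp [clSem, ih]

theorem mem_csSem_iff {D : Type} (I : Interp D) (F : ClauseSet) (x : D) :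
    x ∈ csSem I F ↔ ∀ CL ∈ F, x ∈ clSem I CL := by
  induction F with
  | nil => simp [csSem]
  | cons CL F ih => simp [csSem, ih]

/-- A bounded morphism: it preserves and reflects concept names, and the successors of an
image point are exactly the images of its successors. -/
structure IsBoundedMorphism {D E : Type} (I : Interp D) (J : Interp E) (f : D → E) : Prop where
  cn_iff : ∀ a x, f x ∈ J.cn a ↔ x ∈ I.cn a
  rel_iff : ∀ r x z, J.rel r (f x) z ↔ ∃ y, z = f y ∧ I.rel r x y

namespace IsBoundedMorphism

variable {D E : Type} {I : Interp D} {J : Interp E} {f : D → E}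

mutual
theorem mem_litSem_iff (h : IsBoundedMorphism I J f) (L : Lit) (x : D) :
    f x ∈ litSem J L ↔ x ∈ litSem I L := by
  match L with
  | .pos a => simpa [litSem] using h.cn_iff a x
  | .neg a => simpa [litSem] using not_congr (h.cn_iff a x)
  | .ex r F =>
    have ih := fun y => mem_csSem_iff h F y
    simp only [litSem, Set.mem_ofPred_eq, h.rel_iff]
    constructor
    · rintro ⟨_, ⟨y, rfl, hr⟩, hy⟩
      exact ⟨y, hr, (ih y).1 hy⟩
    · rintro ⟨y, hr, hy⟩
      exact ⟨f y, ⟨y, rfl, hr⟩, (ih y).2 hy⟩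
  | .all r F =>
    have ih := fun y => mem_csSem_iff h F y
    simp only [litSem, Set.mem_ofPred_eq, h.rel_iff]
    constructor
    · exact fun H y hr => (ih y).1 (H (f y) ⟨y, rfl, hr⟩)
    · rintro H _ ⟨y, rfl, hr⟩
      exact (ih y).2 (H y hr)
theorem mem_clSem_iff (h : IsBoundedMorphism I J f) (CL : List Lit) (x : D) :
    f x ∈ clSem J CL ↔ x ∈ clSem I CL := by
  match CL with
  | [] => simp [clSem]
  | L :: CL => simp [clSem, mem_litSem_iff h L x, mem_clSem_iff h CL x]
theorem mem_csSem_iff (h : IsBoundedMorphism I J f) (F : List (List Lit)) (x : D) :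
    f x ∈ csSem J F ↔ x ∈ csSem I F := by
  match F with
  | [] => simp [csSem]
  | CL :: F => simp [csSem, mem_clSem_iff h CL x, mem_csSem_iff h F x]
end

end IsBoundedMorphism

/-- Add a fresh root `none` satisfying the concept names in `V`, whose `r`-successors are the
elements of `succ r`. -/
def Interp.addRoot {D : Type} (I : Interp D) (V : Set ℕ) (succ : ℕ → Set D) :
    Interp (Option D) where
  cn a := {z | match z with
    | none => a ∈ V
    | some y => y ∈ I.cn a}
  rel r z w := match z, w with
    | none, some y => y ∈ succ r
    | some x, some y => I.rel r x y
    | _, none => False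

theorem isBoundedMorphism_some {D : Type} (I : Interp D) (V : Set ℕ) (succ : ℕ → Set D) :
    IsBoundedMorphism I (I.addRoot V succ) some where
  cn_iff _ _ := Iff.rfl
  rel_iff r x z := by cases z <;> simp [Interp.addRoot]

section AddRoot

variable {D : Type} (I : Interp D) (V : Set ℕ) (succ : ℕ → Set D)

theorem none_mem_litSem_pos (a : ℕ) :
    none ∈ litSem (I.addRoot V succ) (.pos a) ↔ a ∈ V := by
  simp [litSem, Interp.addRoot]

theorem none_mem_litSem_neg (a : ℕ) :
    none ∈ litSem (I.addRoot V succ) (.neg a) ↔ a ∉ V := by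
  simp [litSem, Interp.addRoot]

theorem none_mem_litSem_ex (r : ℕ) (F : ClauseSet) :
    none ∈ litSem (I.addRoot V succ) (.ex r F) ↔ ∃ y ∈ succ r, y ∈ csSem I F := by
  simp only [litSem, Set.mem_ofPred_eq, Option.exists,
    (isBoundedMorphism_some I V succ).mem_csSem_iff]
  simp [Interp.addRoot]

theorem none_mem_litSem_all (r : ℕ) (F : ClauseSet) :
    none ∈ litSem (I.addRoot V succ) (.all r F) ↔ ∀ y ∈ succ r, y ∈ csSem I F := by
  simp only [litSem, Set.mem_ofPred_eq, Option.forall,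
    (isBoundedMorphism_some I V succ).mem_csSem_iff]
  simp [Interp.addRoot]

end AddRoot

/-- The disjoint union of two interpretations. -/
def Interp.sum {D E : Type} (I : Interp D) (J : Interp E) : Interp (D ⊕ E) where
  cn a := {z | Sum.elim (· ∈ I.cn a) (· ∈ J.cn a) z}
  rel r := Sum.LiftRel (I.rel r) (J.rel r)

theorem isBoundedMorphism_inl {D E : Type} (I : Interp D) (J : Interp E) :
    IsBoundedMorphism I (I.sum J) Sum.inl where
  cn_iff _ _ := Iff.rfl
  rel_iff r x z := by cases z <;> simp [Interp.sum]

theorem isBoundedMorphism_inr {D E : Type} (I : Interp D) (J : Interp E) :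
    IsBoundedMorphism J (I.sum J) Sum.inr where
  cn_iff _ _ := Iff.rfl
  rel_iff r x z := by cases z <;> simp [Interp.sum]

theorem satisfiable_of_replaceClause {F : ClauseSet} {CL : Clause} {L : Lit} (hL : L ∈ CL)
    (h : Satisfiable (replaceClause F CL [L])) : Satisfiable F := by
  obtain ⟨D, hD, I, x, hx⟩ := h
  refine ⟨D, hD, I, x, (mem_csSem_iff I F x).2 fun c hc => ?_⟩
  have hxc := (mem_csSem_iff I _ x).1 hx _ (List.mem_map_of_mem hc)
  split_ifs at hxc with hcCL
  · subst hcCL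
    exact (mem_clSem_iff I c x).2 ⟨L, hL, by simpa [clSem] using hxc⟩
  · exact hxc

theorem satisfiable_of_applyA2 {r : ℕ} {F₁ F : ClauseSet}
    (h : Satisfiable (applyA2 r F₁ F)) : Satisfiable F := by
  obtain ⟨D, hD, I, x, hx⟩ := h
  refine ⟨Option D, ⟨none⟩,
    I.addRoot {a | x ∈ I.cn a} (fun s => {y | I.rel s x y ∧ (s = r → y ∈ csSem I F₁)}),
    none, (mem_csSem_iff _ F none).2 fun c hc => (mem_clSem_iff _ c none).2 ?_⟩
  by_cases hall : Lit.all r F₁ ∈ c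
  · exact ⟨_, hall, (none_mem_litSem_all ..).2 fun y hy => hy.2 rfl⟩
  have hxc := (mem_csSem_iff I _ x).1 hx _
    (List.mem_map_of_mem (List.mem_filter.2 ⟨hc, by simpa using hall⟩))
  obtain ⟨L', hL', hxL⟩ := (mem_clSem_iff I _ x).1 hxc
  obtain ⟨L, hL, rfl⟩ := List.mem_map.1 hL'
  refine ⟨L, hL, ?_⟩
  cases L with
  | pos a => exact (none_mem_litSem_pos ..).2 (by simpa [litSem] using hxL)
  | neg a => exact (none_mem_litSem_neg ..).2 (by simpa [litSem] using hxL)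
  | all s G =>
    simp only [litSem, Set.mem_ofPred_eq] at hxL
    exact (none_mem_litSem_all ..).2 fun y hy => hxL y hy.1
  | ex s G =>
    refine (none_mem_litSem_ex ..).2 ?_
    dsimp only at hxL
    split_ifs at hxL with hs
    · obtain ⟨y, hr, hy⟩ : ∃ y, I.rel s x y ∧ y ∈ csSem I (F₁ ++ G) := by
        simpa [litSem] using hxL
      rw [mem_csSem_iff, List.forall_mem_append] at hy
      exact ⟨y, ⟨hr, fun _ => (mem_csSem_iff ..).2 hy.1⟩, (mem_csSem_iff ..).2 hy.2⟩
    · obtain ⟨y, hr, hy⟩ : ∃ y, I.rel s x y ∧ y ∈ csSem I G := by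
        simpa [litSem] using hxL
      exact ⟨y, ⟨hr, fun h => absurd h hs⟩, hy⟩

theorem satisfiable_of_removeClause {r : ℕ} {F₁ F : ClauseSet} (hF : ∀ CL ∈ F, IsA3Unit CL)
    (h : Satisfiable (removeClause F [Lit.ex r F₁])) (h₁ : Satisfiable F₁) : Satisfiable F := by
  obtain ⟨D, hD, I, x, hx⟩ := h
  obtain ⟨E, hE, J, z, hz⟩ := h₁
  refine ⟨Option (D ⊕ E), ⟨none⟩,
    (I.sum J).addRoot {a | x ∈ I.cn a} (fun s => {w | Sum.elim (I.rel s x) (fun _ => True) w}),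
    none, (mem_csSem_iff _ F none).2 fun c hc => ?_⟩
  have hxc (hne : c ≠ [Lit.ex r F₁]) : x ∈ clSem I c :=
    (mem_csSem_iff I _ x).1 hx _ (List.mem_filter.2 ⟨hc, by simpa using hne⟩)
  obtain ⟨a, rfl⟩ | ⟨a, rfl⟩ | ⟨s, G, rfl⟩ := hF c hc
  · have := hxc (by simp)
    rw [mem_clSem_iff]
    exact ⟨_, List.mem_singleton_self _,
      (none_mem_litSem_pos ..).2 (by simpa [clSem, litSem] using this)⟩
  · have := hxc (by simp)
    rw [mem_clSem_iff]
    exact ⟨_, List.mem_singleton_self _,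
      (none_mem_litSem_neg ..).2 (by simpa [clSem, litSem] using this)⟩
  · rw [mem_clSem_iff]
    refine ⟨_, List.mem_singleton_self _, (none_mem_litSem_ex ..).2 ?_⟩
    by_cases hne : [Lit.ex s G] = [Lit.ex r F₁]
    · obtain ⟨rfl, rfl⟩ : s = r ∧ G = F₁ := by simpa using hne
      exact ⟨.inr z, trivial, ((isBoundedMorphism_inr I J).mem_csSem_iff G z).2 hz⟩
    · obtain ⟨y, hr, hy⟩ : ∃ y, I.rel s x y ∧ y ∈ csSem I G := by
        simpa [clSem, litSem] using hxc hne
      exact ⟨.inl y, hr, ((isBoundedMorphism_inl I J).mem_csSem_iff G y).2 hy⟩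

theorem forall_satisfiable_of_replaceCS {S : List ClauseSet} {F F' : ClauseSet}
    (hFF' : Satisfiable F' → Satisfiable F)
    (h : ∀ G ∈ replaceCS S F F', Satisfiable G) : ∀ G ∈ S, Satisfiable G := by
  intro G hG
  have hG' := h _ (List.mem_map_of_mem hG)
  split_ifs at hG' with hGF
  · exact hGF ▸ hFF' hG'
  · exact hG'

theorem Step.forall_satisfiable {S S' : List ClauseSet} (hstep : Step S S')
    (h : ∀ F ∈ S', Satisfiable F) : ∀ F ∈ S, Satisfiable F := by
  cases hstep with
  | a1 _ _ hL _ => exact forall_satisfiable_of_replaceCS (satisfiable_of_replaceClause hL) h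
  | a2 _ _ _ => exact forall_satisfiable_of_replaceCS satisfiable_of_applyA2 h
  | a3 _ hF _ =>
    rw [List.forall_mem_append] at h
    exact forall_satisfiable_of_replaceCS
      (fun h' => satisfiable_of_removeClause hF h' (h.2 _ (List.mem_singleton_self _))) h.1

/-- Unsatisfiability inheritance: if Sᵢ₊₁ is derived from Sᵢ by
    one of the rules A1, A2, A3 and some clause set in Sᵢ is unsatisfiable, then
    some clause set in Sᵢ₊₁ is unsatisfiable; equivalently, if every clause set
    in Sᵢ₊₁ is satisfiable then every clause set in Sᵢ is satisfiable. -/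
theorem unsat_inheritance (Si Si1 : List ClauseSet) (hstep : Step Si Si1) :
    ((∃ F ∈ Si, ¬ Satisfiable F) → ∃ F ∈ Si1, ¬ Satisfiable F) ∧
    ((∀ F ∈ Si1, Satisfiable F) → ∀ F ∈ Si, Satisfiable F) := by
  have h := hstep.forall_satisfiable
  refine ⟨?_, h⟩
  rintro ⟨F, hF, hunsat⟩
  by_contra! hsat
  exact hunsat (h hsat F hF)

end ALCCS
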